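/- Let L be the lattice ℤ^12 with the positive-definite symmetric bilinear form given by the Gram matrix with rows [4,1,−2,−2,1,2,−2,−1,−2,−2,−2,2], [1,4,−2,−1,1,0,0,1,−2,1,1,2], [−2,−2,4,2,−2,0,0,1,1,1,1,−1], [−2,−1,2,4,0,−2,1,2,0,2,0,−2], [1,1,−2,0,4,−1,−1,−1,−1,1,0,−1], [2,0,0,−2,−1,4,−2,0,0,−1,0,2], [−2,0,0,1,−1,−2,4,1,0,0,1,0], [−1,1,1,2,−1,0,1,4,0,2,1,0], [−2,−2,1,0,−1,0,0,0,4,0,0,−2], [−2,1,1,2,1,−1,0,2,0,4,2,−1], [−2,1,1,0,0,0,1,1,0,2,4,0], [2,2,−1,−2,−1,2,0,0,−2,−1,0,4]. Then there exists a primitive isometric embedding of the lattice E6(2) into L. -/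

import Mathlib

open Matrix

/-- Gram matrix of the rank-12 positive-definite lattice `L`. -/
def gramL12 : Matrix (Fin 12) (Fin 12) ℤ :=
  !![ 4,  1, -2, -2,  1,  2, -2, -1, -2, -2, -2,  2;
      1,  4, -2, -1,  1,  0,  0,  1, -2,  1,  1,  2;
     -2, -2,  4,  2, -2,  0,  0,  1,  1,  1,  1, -1;
     -2, -1,  2,  4,  0, -2,  1,  2,  0,  2,  0, -2;
      1,  1, -2,  0,  4, -1, -1, -1, -1,  1,  0, -1;
      2,  0,  0, -2, -1,  4, -2,  0,  0, -1,  0,  2;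
     -2,  0,  0,  1, -1, -2,  4,  1,  0,  0,  1,  0;
     -1,  1,  1,  2, -1,  0,  1,  4,  0,  2,  1,  0;
     -2, -2,  1,  0, -1,  0,  0,  0,  4,  0,  0, -2;
     -2,  1,  1,  2,  1, -1,  0,  2,  0,  4,  2, -1;
     -2,  1,  1,  0,  0,  0,  1,  1,  0,  2,  4,  0;
      2,  2, -1, -2, -1,  2,  0,  0, -2, -1,  0,  4]

/-- Gram matrix of the root lattice `E₆` (standard Cartan matrix, Bourbaki numbering). -/
def gramE6 : Matrix (Fin 6) (Fin 6) ℤ :=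
  !![ 2,  0, -1,  0,  0,  0;
      0,  2,  0, -1,  0,  0;
     -1,  0,  2, -1,  0,  0;
      0, -1, -1,  2, -1,  0;
      0,  0,  0, -1,  2, -1;
      0,  0,  0,  0, -1,  2]

/-- The columns of this matrix are minimal vectors of `L` spanning a copy of `E₆(2)`. -/
def embE6 : Matrix (Fin 12) (Fin 6) ℤ :=
  !![ 1,  0, -1,  1,  0,  0;
      0,  0,  0,  0,  0,  0;
     -1,  0,  1, -1,  1,  0;
      1,  0,  0,  1, -2,  1;
     -1,  1,  1, -1,  0,  0;
      0,  0,  0,  0,  0,  0;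
      0,  0,  0,  0,  1, -1;
     -1,  0,  0,  0,  0,  0;
      0,  0,  0,  1, -1,  0;
      0,  0,  0,  0,  1, -1;
      1,  0, -1,  1, -1,  1;
      0,  0,  1,  0, -1,  0]

/-- An integral left inverse of `embE6`. -/
def embE6LeftInv : Matrix (Fin 6) (Fin 12) ℤ :=
  !![ 0,  0,  0,  0,  0,  0,  0, -1,  0,  0,  0,  0;
      1,  0,  0,  0,  1,  0,  0,  0,  0,  0,  0,  0;
      0,  0,  1,  1,  0,  0,  1,  0,  0,  0,  0,  0;
      1,  0,  1,  1,  0,  0,  1,  1,  0,  0,  0,  0;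
      1,  0,  1,  0,  0,  0,  0,  0,  0,  0,  0,  0;
      1,  0,  1,  0,  0,  0, -1,  0,  0,  0,  0,  0]

theorem embE6LeftInv_mul_embE6 : embE6LeftInv * embE6 = 1 := by
  decide +kernel

theorem embE6_transpose_mul_gramL12_mul_embE6 :
    embE6ᵀ * gramL12 * embE6 = (2 : ℤ) • gramE6 := by
  decide +kernel

/-- The cokernel of an integral matrix with an integral left inverse is torsion-free. -/
theorem mem_range_mulVecLin_of_smul_mem {m k : Type*} [Fintype m] [Fintype k] [DecidableEq k]
    {A : Matrix m k ℤ} {P : Matrix k m ℤ} (h : P * A = 1) {x : m → ℤ} {n : ℤ} (hn : n ≠ 0)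
    (hx : n • x ∈ LinearMap.range A.mulVecLin) : x ∈ LinearMap.range A.mulVecLin := by
  obtain ⟨y, hy⟩ := hx
  rw [mulVecLin_apply] at hy
  have hPy : y = n • P *ᵥ x := by
    rw [← mulVec_smul, ← hy, mulVec_mulVec, h, one_mulVec]
  refine ⟨P *ᵥ x, smul_right_injective _ hn ?_⟩
  change n • A *ᵥ (P *ᵥ x) = n • x
  rw [← hy, hPy, mulVec_smul]

/-- There exists a primitive isometric embedding of the lattice `E₆(2)`
into the rank-12 lattice `L = (ℤ¹², gramL12)`. -/
theorem stmt_15 :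
    ∃ f : (Fin 6 → ℤ) →ₗ[ℤ] (Fin 12 → ℤ),
      Function.Injective f ∧
      (∀ v w : Fin 6 → ℤ, f v ⬝ᵥ gramL12.mulVec (f w) = 2 * (v ⬝ᵥ gramE6.mulVec w)) ∧
      -- primitivity: the cokernel of f is torsion-free
      (∀ (x : Fin 12 → ℤ) (n : ℤ), n ≠ 0 → n • x ∈ LinearMap.range f →
        x ∈ LinearMap.range f) := by
  refine ⟨embE6.mulVecLin, ?_, fun v w => ?_,
    fun x n hn hx => mem_range_mulVecLin_of_smul_mem embE6LeftInv_mul_embE6 hn hx⟩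
  · refine Function.LeftInverse.injective (g := embE6LeftInv.mulVec) fun v => ?_
    rw [mulVecLin_apply, mulVec_mulVec, embE6LeftInv_mul_embE6, one_mulVec]
  · rw [mulVecLin_apply, mulVecLin_apply, ← vecMul_transpose, ← dotProduct_mulVec,
      mulVec_mulVec, mulVec_mulVec, embE6_transpose_mul_gramL12_mul_embE6,
      smul_mulVec, dotProduct_smul, smul_eq_mul]
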